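/- Let q : ℝⁿ → (1,∞) satisfy 1 < q_- ≤ q_+ < ∞, and suppose the Hardy–Littlewood maximal operator M is bounded on L^{q(·)}(ℝⁿ). Then there exist δ ∈ (0,1) and C > 0 such that for every ball B ⊂ ℝⁿ and every measurable S ⊆ B, ‖χ_S‖_{L^{q(·)}} / ‖χ_B‖_{L^{q(·)}} ≤ C (|S|/|B|)^δ. -/

import Mathlib

open MeasureTheory Metric
open scoped ENNReal

/-- The Luxemburg norm of `f` in the variable exponent Lebesgue space `L^{q(·)}(ℝⁿ)`. -/
noncomputable def vLpNorm {n : ℕ} (q : EuclideanSpace ℝ (Fin n) → ℝ)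
    (f : EuclideanSpace ℝ (Fin n) → ℝ) : ℝ≥0∞ :=
  sInf {η : ℝ≥0∞ | η ≠ 0 ∧ ∫⁻ x, ((‖f x‖₊ : ℝ≥0∞) / η) ^ (q x) ≤ 1}

/-- The Hardy–Littlewood maximal operator `Mf(x) = sup_{r>0} r^{-n} ∫_{B(x,r)} |f|`. -/
noncomputable def maxOp {n : ℕ} (f : EuclideanSpace ℝ (Fin n) → ℝ)
    (x : EuclideanSpace ℝ (Fin n)) : ℝ :=
  ⨆ r : {r : ℝ // 0 < r}, (r : ℝ) ^ (-(n:ℝ)) * ∫ y in ball x (r : ℝ), |f y|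

namespace Stmt11Aux

/-- norm of the characteristic function of a set -/
noncomputable def N {n : ℕ} (q : EuclideanSpace ℝ (Fin n) → ℝ)
    (F : Set (EuclideanSpace ℝ (Fin n))) : ℝ≥0∞ :=
  vLpNorm q (F.indicator fun _ => (1:ℝ))

variable {n : ℕ} {q : EuclideanSpace ℝ (Fin n) → ℝ}

lemma vol_ball (x : EuclideanSpace ℝ (Fin n)) {r : ℝ} (hr : 0 < r) :
    volume.real (ball x r) = r ^ n * volume.real (ball (0 : EuclideanSpace ℝ (Fin n)) 1) := by
  rw [measureReal_def, Measure.addHaar_ball_of_pos _ _ hr, ENNReal.toReal_mul,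
    ENNReal.toReal_ofReal (by positivity)]
  simp [measureReal_def]

lemma modular_eq (hq1 : ∀ x, 1 < q x) {F : Set (EuclideanSpace ℝ (Fin n))}
    (hF : MeasurableSet F) (η : ℝ≥0∞) :
    ∫⁻ x, ((‖F.indicator (fun _ => (1:ℝ)) x‖₊ : ℝ≥0∞) / η) ^ (q x)
      = ∫⁻ x in F, (η⁻¹) ^ (q x) := by
  rw [← lintegral_indicator hF]
  congr 1
  ext x
  by_cases hx : x ∈ F
  · simp [hx]
  · have : 0 < q x := by linarith [hq1 x]
    simp [hx, this]

lemma N_le (hq1 : ∀ x, 1 < q x) {F : Set (EuclideanSpace ℝ (Fin n))}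
    (hF : MeasurableSet F) {η : ℝ≥0∞} (h0 : η ≠ 0)
    (h : ∫⁻ x in F, (η⁻¹) ^ (q x) ≤ 1) : N q F ≤ η := by
  apply sInf_le
  exact ⟨h0, by rw [modular_eq hq1 hF]; exact h⟩

lemma le_N (hq1 : ∀ x, 1 < q x) {F : Set (EuclideanSpace ℝ (Fin n))}
    (hF : MeasurableSet F) {a : ℝ≥0∞}
    (h : ∀ η : ℝ≥0∞, η ≠ 0 → ∫⁻ x in F, (η⁻¹) ^ (q x) ≤ 1 → a ≤ η) : a ≤ N q F := by
  apply le_sInf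
  rintro η ⟨h0, h1⟩
  rw [modular_eq hq1 hF] at h1
  exact h η h0 h1

lemma N_mono (hq1 : ∀ x, 1 < q x) {F G : Set (EuclideanSpace ℝ (Fin n))}
    (hF : MeasurableSet F) (hG : MeasurableSet G) (h : F ⊆ G) : N q F ≤ N q G :=
  le_N hq1 hG fun _ h0 h1 => N_le hq1 hF h0 ((lintegral_mono_set h).trans h1)

lemma scale (hq1 : ∀ x, 1 < q x) {K : ℝ} (hK : ∀ x, q x ≤ K) {c : ℝ} (hc : 0 < c) (hc1 : c ≤ 1)
    (F : Set (EuclideanSpace ℝ (Fin n))) (η : ℝ≥0∞) :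
    ∫⁻ x in F, ((ENNReal.ofReal c * η)⁻¹) ^ (q x) ≤
      (ENNReal.ofReal c)⁻¹ ^ K * ∫⁻ x in F, (η⁻¹) ^ (q x) := by
  have hc0 : ENNReal.ofReal c ≠ 0 := by simpa using hc
  have hi1 : 1 ≤ (ENNReal.ofReal c)⁻¹ := by
    rw [ENNReal.one_le_inv]; simpa using hc1
  rw [← lintegral_const_mul' _ _ (by
    rw [← ENNReal.ofReal_inv_of_pos hc, ENNReal.ofReal_rpow_of_pos (by positivity)]; simp)]
  apply lintegral_mono
  intro x
  simp only
  rw [ENNReal.mul_inv (Or.inl hc0) (Or.inl ENNReal.ofReal_ne_top)]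
  rw [ENNReal.mul_rpow_of_nonneg _ _ (by linarith [hq1 x])]
  gcongr
  exact hK x

lemma N_max (hq1 : ∀ x, 1 < q x) {A : ℝ≥0∞}
    (hM : ∀ f : EuclideanSpace ℝ (Fin n) → ℝ, vLpNorm q (maxOp f) ≤ A * vLpNorm q f)
    {F H : Set (EuclideanSpace ℝ (Fin n))} (hF : MeasurableSet F) (hH : MeasurableSet H)
    {κ : ℝ} (hκ : 0 < κ)
    (h : ∀ x ∈ F, ∃ r : ℝ, 0 < r ∧ κ * r ^ n ≤ volume.real (H ∩ ball x r)) :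
    ENNReal.ofReal κ * N q F ≤ A * N q H := by
  refine le_trans ?_ (hM (H.indicator fun _ => (1:ℝ)))
  apply le_sInf
  rintro η ⟨h0, h1⟩
  have hκ0 : ENNReal.ofReal κ ≠ 0 := by simpa using hκ
  rw [mul_comm, ← ENNReal.le_div_iff_mul_le (Or.inl hκ0) (Or.inl ENNReal.ofReal_ne_top)]
  apply N_le hq1 hF
  · simp [h0]
  refine le_trans ?_ h1
  rw [← lintegral_indicator hF]
  apply lintegral_mono
  intro x
  by_cases hx : x ∈ F
  swap
  · simp [hx]
  simp only [hx, Set.indicator_of_mem]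
  have hqx : 0 ≤ q x := by linarith [hq1 x]
  apply ENNReal.rpow_le_rpow _ hqx
  rw [ENNReal.inv_div (Or.inl ENNReal.ofReal_ne_top) (Or.inl hκ0)]
  gcongr
  have key : κ ≤ maxOp (H.indicator fun _ => (1:ℝ)) x := by
    obtain ⟨r, hr, hr2⟩ := h x hx
    have hint : ∀ s : ℝ, ∫ y in ball x s, |H.indicator (fun _ => (1:ℝ)) y|
        = volume.real (H ∩ ball x s) := by
      intro s
      have : (fun y => |H.indicator (fun _ => (1:ℝ)) y|) = H.indicator (fun _ => (1:ℝ)) := by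
        ext y; by_cases hy : y ∈ H <;> simp [hy]
      rw [this, integral_indicator hH]
      simp [hH]
    have hb : BddAbove (Set.range fun s : {r : ℝ // 0 < r} =>
      (s : ℝ) ^ (-(n:ℝ)) * ∫ y in ball x (s : ℝ), |H.indicator (fun _ => (1:ℝ)) y|) := by
      refine ⟨volume.real (ball (0 : EuclideanSpace ℝ (Fin n)) 1), ?_⟩
      rintro _ ⟨⟨s, hs⟩, rfl⟩
      simp only [hint]
      have h1 : volume.real (H ∩ ball x s) ≤ volume.real (ball x s) :=
        measureReal_mono Set.inter_subset_right
      rw [vol_ball x hs] at h1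
      rw [Real.rpow_neg hs.le, Real.rpow_natCast]
      rw [inv_mul_le_iff₀ (by positivity)]
      exact h1
    refine le_trans ?_ (le_ciSup hb ⟨r, hr⟩)
    simp only [hint]
    rw [Real.rpow_neg hr.le, Real.rpow_natCast, le_inv_mul_iff₀ (by positivity)]
    linarith
  rw [← ENNReal.ofReal_coe_nnreal]
  apply ENNReal.ofReal_le_ofReal
  simpa using key.trans (le_abs_self _)

lemma N_theta (hq1 : ∀ x, 1 < q x) {K : ℝ} (hK : ∀ x, q x ≤ K) {L : ℝ} (hL : 1 ≤ L) :
    ∃ θ : ℝ, 1 / 2 ≤ θ ∧ θ < 1 ∧ ∀ E G : Set (EuclideanSpace ℝ (Fin n)), MeasurableSet E →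
      MeasurableSet G → E ⊆ G → N q G ≤ ENNReal.ofReal L * N q (G \ E) →
      N q E ≤ ENNReal.ofReal θ * N q G := by
  have hK1 : 1 < K := (hq1 0).trans_le (hK 0)
  set c : ℝ := (2 * L)⁻¹ with hc
  have hc0 : 0 < c := by positivity
  have hc1 : c ≤ 1 / 2 := by
    rw [hc, one_div]; gcongr; linarith
  set ε : ℝ := c ^ K with hε
  have hε0 : 0 < ε := by positivity
  have hε1 : ε ≤ 1 / 2 := by
    have := Real.rpow_le_rpow_of_exponent_ge hc0 (by linarith) hK1.le
    rw [Real.rpow_one] at this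
    linarith
  refine ⟨(1 - ε) ^ (1 / K), ?_, ?_, ?_⟩
  · have := Real.rpow_le_rpow_of_exponent_ge (x := 1 - ε) (y := 1) (z := 1 / K) (by linarith)
      (by linarith) (by rw [div_le_one (by linarith)]; linarith)
    rw [Real.rpow_one] at this
    linarith
  · apply Real.rpow_lt_one <;> first | positivity | linarith
  have hθ2 : 1 / 2 ≤ (1 - ε) ^ (1 / K) := by
    have := Real.rpow_le_rpow_of_exponent_ge (x := 1 - ε) (y := 1) (z := 1 / K) (by linarith)
      (by linarith) (by rw [div_le_one (by linarith)]; linarith)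
    rw [Real.rpow_one] at this
    linarith
  have hθ3 : (1 - ε) ^ (1 / K) ≤ 1 := by
    apply Real.rpow_le_one <;> first | positivity | linarith
  have hθK : ((1 - ε) ^ (1 / K)) ^ K = 1 - ε := by
    rw [← Real.rpow_mul (by linarith), one_div_mul_cancel (by linarith), Real.rpow_one]
  generalize (1 - ε) ^ (1 / K) = θ at hθ2 hθ3 hθK
  intro E G hE hG hEG hN
  have hθ0 : 0 < θ := by linarith
  rw [mul_comm, ← ENNReal.div_le_iff_le_mul (by simp [hθ0]) (by simp)]
  refine le_N hq1 hG fun η h0 h1 => ?_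
  rw [ENNReal.div_le_iff_le_mul (by simp [hθ0]) (by simp), mul_comm]
  by_cases hη : η < 2 * N q G
  swap
  · have h2 : N q E ≤ N q G := N_mono hq1 hE hG hEG
    refine h2.trans ?_
    calc N q G = ENNReal.ofReal (1/2) * (2 * N q G) := by
          rw [← mul_assoc, one_div, ENNReal.ofReal_inv_of_pos (by norm_num)]
          simp [ENNReal.inv_mul_cancel]
      _ ≤ ENNReal.ofReal θ * η := by
          gcongr
          exact not_lt.1 hη
  have hηt : η ≠ ⊤ := ne_top_of_lt hη
  have hH : MeasurableSet (G \ E) := hG.diff hE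
  have hlow : ENNReal.ofReal ε ≤ ∫⁻ x in G \ E, (η⁻¹) ^ (q x) := by
    by_contra! hcon
    have h3 : N q (G \ E) ≤ ENNReal.ofReal c * η := by
      apply N_le hq1 hH
      · simp [h0, hc0]
      refine (scale hq1 hK hc0 (by linarith) _ _).trans ?_
      calc _ ≤ (ENNReal.ofReal c)⁻¹ ^ K * ENNReal.ofReal ε := by gcongr
        _ = 1 := by
          rw [ENNReal.inv_rpow, ENNReal.ofReal_rpow_of_pos hc0]
          exact ENNReal.inv_mul_cancel (by simpa using hε0) (by simp)
    apply absurd hη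
    rw [not_lt]
    calc 2 * N q G ≤ 2 * (ENNReal.ofReal L * (ENNReal.ofReal c * η)) := by
          gcongr; exact hN.trans (by gcongr)
      _ = ENNReal.ofReal (2 * (L * c)) * η := by
          rw [ENNReal.ofReal_mul (by norm_num), ENNReal.ofReal_mul (by linarith)]
          simp [mul_assoc]
      _ = η := by
          have : 2 * (L * c) = 1 := by rw [hc]; field_simp
          rw [this]; simp
  have hsum : (∫⁻ x in E, (η⁻¹) ^ (q x)) + (∫⁻ x in G \ E, (η⁻¹) ^ (q x)) ≤ 1 := by
    rw [← lintegral_union hH Set.disjoint_sdiff_right, Set.union_sdiff_cancel hEG]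
    exact h1
  have hE1 : ∫⁻ x in E, (η⁻¹) ^ (q x) ≤ ENNReal.ofReal (1 - ε) := by
    rw [ENNReal.ofReal_sub _ hε0.le, ENNReal.ofReal_one]
    apply ENNReal.le_sub_of_add_le_right (by simp)
    exact le_trans (add_le_add_right hlow _) hsum
  apply N_le hq1 hE
  · simp [h0, hθ0]
  refine (scale hq1 hK hθ0 hθ3 _ _).trans ?_
  calc _ ≤ (ENNReal.ofReal θ)⁻¹ ^ K * ENNReal.ofReal (1 - ε) := by gcongr
    _ = 1 := by
      rw [ENNReal.inv_rpow, ENNReal.ofReal_rpow_of_pos hθ0, hθK]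
      exact ENNReal.inv_mul_cancel (by simp; linarith) (by simp)

/-- volume of the unit ball -/
noncomputable def v (n : ℕ) : ℝ := volume.real (ball (0 : EuclideanSpace ℝ (Fin n)) 1)

lemma v_pos : 0 < v n :=
  ENNReal.toReal_pos (measure_ball_pos _ _ one_pos).ne' measure_ball_lt_top.ne

lemma vol_ball' (x : EuclideanSpace ℝ (Fin n)) {r : ℝ} (hr : 0 < r) :
    volume.real (ball x r) = r ^ n * v n := vol_ball x hr

/-- the balls in which `E` has a definite proportion -/
def T (E : Set (EuclideanSpace ℝ (Fin n))) : Set (EuclideanSpace ℝ (Fin n) × ℝ) :=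
  {p | 0 < p.2 ∧ p.2 ^ n * v n < 2 ^ (n + 1) * volume.real (E ∩ ball p.1 p.2)}

/-- the union of these balls -/
def Phi (E : Set (EuclideanSpace ℝ (Fin n))) : Set (EuclideanSpace ℝ (Fin n)) :=
  ⋃ p ∈ T E, ball p.1 p.2

lemma Phi_open (E : Set (EuclideanSpace ℝ (Fin n))) : IsOpen (Phi E) :=
  isOpen_biUnion fun _ _ => isOpen_ball

lemma sub_Phi {E : Set (EuclideanSpace ℝ (Fin n))} (hE : IsOpen E) : E ⊆ Phi E := by
  intro x hx
  obtain ⟨s, hs, hsE⟩ := Metric.isOpen_iff.1 hE x hx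
  refine Set.mem_biUnion (x := (x, s)) ⟨hs, ?_⟩ (mem_ball_self hs)
  simp only
  rw [Set.inter_eq_right.2 hsE, vol_ball' x hs]
  have h1 : (1:ℝ) < 2 ^ (n + 1) := one_lt_pow₀ (by norm_num) (by omega)
  have h2 : 0 < s ^ n * v n := mul_pos (by positivity) v_pos
  nlinarith

lemma T_radius (hn : 0 < n) {E : Set (EuclideanSpace ℝ (Fin n))} (hfin : volume E ≠ ⊤) {σ : ℝ}
    (hσ : 0 < σ) (hvol : volume.real E ≤ σ ^ n * v n) {p : EuclideanSpace ℝ (Fin n) × ℝ}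
    (hp : p ∈ T E) : p.2 < 4 * σ := by
  obtain ⟨h0, h1⟩ := hp
  have h2 : volume.real (E ∩ ball p.1 p.2) ≤ volume.real E :=
    measureReal_mono Set.inter_subset_left hfin
  have h3 : (2:ℝ) ^ (n + 1) ≤ 4 ^ n := by
    rw [show (4:ℝ) = 2 ^ 2 by norm_num, ← pow_mul]
    exact pow_le_pow_right₀ (by norm_num) (by omega)
  have h4 : p.2 ^ n * v n < (4 * σ) ^ n * v n := by
    calc p.2 ^ n * v n < 2 ^ (n + 1) * volume.real (E ∩ ball p.1 p.2) := h1
      _ ≤ 4 ^ n * (σ ^ n * v n) := by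
        gcongr
        exact h2.trans hvol
      _ = _ := by rw [mul_pow]; ring
  exact lt_of_pow_lt_pow_left₀ n (by positivity) (lt_of_mul_lt_mul_right h4 v_pos.le)

lemma Phi_sub (hn : 0 < n) {E : Set (EuclideanSpace ℝ (Fin n))} (hfin : volume E ≠ ⊤) {σ ρ : ℝ}
    (hσ : 0 < σ) (hvol : volume.real E ≤ σ ^ n * v n) {c : EuclideanSpace ℝ (Fin n)}
    (hE : E ⊆ ball c ρ) : Phi E ⊆ ball c (ρ + 8 * σ) := by
  intro x hx
  obtain ⟨p, hp, hxp⟩ := Set.mem_iUnion₂.1 hx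
  have hr := T_radius hn hfin hσ hvol hp
  obtain ⟨h0, h1⟩ := hp
  have hne : (E ∩ ball p.1 p.2).Nonempty := by
    by_contra hcon
    rw [Set.not_nonempty_iff_eq_empty] at hcon
    rw [hcon] at h1
    simp only [measureReal_empty, mul_zero] at h1
    have : 0 < p.2 ^ n * v n := mul_pos (by positivity) v_pos
    linarith
  obtain ⟨z, hzE, hzp⟩ := hne
  have h3 := hE hzE
  rw [mem_ball] at *
  have h4 := dist_triangle x z c
  have h5 := dist_triangle_right x z p.1
  linarith

lemma Phi_vol (hn : 0 < n) {E : Set (EuclideanSpace ℝ (Fin n))} (hEm : MeasurableSet E)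
    (hfin : volume E ≠ ⊤) {σ : ℝ}
    (hσ : 0 < σ) (hvol : volume.real E ≤ σ ^ n * v n) :
    volume.real (Phi E) ≤ 20 ^ n * volume.real E := by
  obtain ⟨u, hut, hdisj, hcov⟩ :=
    Vitali.exists_disjoint_subfamily_covering_enlargement_closedBall (T E) (fun p => p.1)
      (fun p => p.2) (4 * σ) (fun p hp => (T_radius hn hfin hσ hvol hp).le) 5 (by norm_num)
  have hcount : u.Countable := by
    apply hdisj.countable_of_nonempty_interior
    intro p hp
    exact ⟨p.1, ball_subset_interior_closedBall (mem_ball_self (hut hp).1)⟩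
  have hsub : Phi E ⊆ ⋃ p ∈ u, closedBall p.1 (5 * p.2) := by
    intro x hx
    obtain ⟨p, hp, hxp⟩ := Set.mem_iUnion₂.1 hx
    obtain ⟨b, hb, hb2⟩ := hcov p hp
    exact Set.mem_biUnion hb (hb2 (ball_subset_closedBall hxp))
  have hterm : ∀ p ∈ u, volume (closedBall p.1 (5 * p.2)) ≤
      ENNReal.ofReal (20 ^ n) * volume (E ∩ ball p.1 p.2) := by
    intro p hp
    obtain ⟨h0, h1⟩ := hut hp
    have hf : volume (E ∩ ball p.1 p.2) ≠ ⊤ := measure_ne_top_of_subset Set.inter_subset_left hfin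
    rw [← ENNReal.ofReal_toReal hf, ← ENNReal.ofReal_mul (by positivity),
      ← ENNReal.ofReal_toReal (measure_closedBall_lt_top (x := p.1) (r := 5 * p.2)
        (μ := volume)).ne]
    apply ENNReal.ofReal_le_ofReal
    have h2 := Measure.addHaar_real_closedBall (volume : Measure (EuclideanSpace ℝ (Fin n))) p.1
      (r := 5 * p.2) (by positivity)
    simp only [finrank_euclideanSpace, Fintype.card_fin] at h2
    rw [measureReal_def] at h2
    rw [h2]
    change _ * v n ≤ _
    have h3 : (2:ℝ) ^ (n + 1) ≤ 4 ^ n := by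
      rw [show (4:ℝ) = 2 ^ 2 by norm_num, ← pow_mul]
      exact pow_le_pow_right₀ (by norm_num) (by omega)
    calc (5 * p.2) ^ n * v n = 5 ^ n * (p.2 ^ n * v n) := by rw [mul_pow]; ring
      _ ≤ 5 ^ n * (4 ^ n * volume.real (E ∩ ball p.1 p.2)) := by
        refine mul_le_mul_of_nonneg_left (h1.le.trans ?_) (by positivity)
        exact mul_le_mul_of_nonneg_right h3 measureReal_nonneg
      _ = _ := by
        rw [show (20:ℝ) = 5 * 4 by norm_num, mul_pow, measureReal_def]; ring
  have hmain : volume (Phi E) ≤ ENNReal.ofReal (20 ^ n) * volume E := by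
    calc volume (Phi E) ≤ volume (⋃ p ∈ u, closedBall p.1 (5 * p.2)) := measure_mono hsub
      _ ≤ ∑' p : u, volume (closedBall p.1.1 (5 * p.1.2)) := measure_biUnion_le _ hcount _
      _ ≤ ∑' p : u, ENNReal.ofReal (20 ^ n) * volume (E ∩ ball p.1.1 p.1.2) :=
        ENNReal.tsum_le_tsum fun p => hterm p.1 p.2
      _ = ENNReal.ofReal (20 ^ n) * ∑' p : u, volume (E ∩ ball p.1.1 p.1.2) :=
        ENNReal.tsum_mul_left
      _ = ENNReal.ofReal (20 ^ n) * volume (⋃ p ∈ u, E ∩ ball p.1 p.2) := by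
        rw [measure_biUnion hcount]
        · intro a ha b hb hab
          exact (hdisj ha hb hab).mono
            (Set.inter_subset_right.trans ball_subset_closedBall)
            (Set.inter_subset_right.trans ball_subset_closedBall)
        · intro p _
          exact hEm.inter measurableSet_ball
      _ ≤ ENNReal.ofReal (20 ^ n) * volume E := by
        gcongr
        exact Set.iUnion₂_subset fun _ _ => Set.inter_subset_left
  have := ENNReal.toReal_mono (ENNReal.mul_ne_top ENNReal.ofReal_ne_top hfin) hmain
  rwa [ENNReal.toReal_mul, ENNReal.toReal_ofReal (by positivity)] at this

lemma Phi_max (hn : 0 < n) {E : Set (EuclideanSpace ℝ (Fin n))} (hEm : MeasurableSet E)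
    (hfin : volume E ≠ ⊤) {σ : ℝ}
    (hσ : 0 < σ) (hvol : volume.real E ≤ σ ^ n * v n) {x : EuclideanSpace ℝ (Fin n)}
    (hx : x ∈ Phi E) :
    ∃ r : ℝ, 0 < r ∧ v n / 2 ^ (n + 1) * r ^ n ≤ volume.real ((Phi E \ E) ∩ ball x r) := by
  obtain ⟨⟨y, s⟩, hp, hxp⟩ := Set.mem_iUnion₂.1 hx
  have hex : ∃ t, s ≤ t ∧ (y, t) ∈ T E ∧ (y, 2 * t) ∉ T E := by
    by_contra! hcon
    have hall : ∀ k : ℕ, (y, 2 ^ k * s) ∈ T E := by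
      intro k
      induction k with
      | zero => simpa using hp
      | succ k ih =>
        have h1 : s ≤ 2 ^ k * s := by
          have : (1:ℝ) ≤ 2 ^ k := one_le_pow₀ (by norm_num)
          have := hp.1
          simp only at this
          nlinarith
        have := hcon _ h1 ih
        rwa [← mul_assoc, ← pow_succ'] at this
    obtain ⟨k, hk⟩ := pow_unbounded_of_one_lt (4 * σ / s) (one_lt_two)
    have h1 := T_radius hn hfin hσ hvol (hall k)
    have h2 : 0 < s := hp.1
    rw [div_lt_iff₀ h2] at hk
    simp only at h1
    linarith
  obtain ⟨t, hst, htT, htn⟩ := hex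
  have ht0 : 0 < t := htT.1
  refine ⟨2 * t, by positivity, ?_⟩
  have h1 : 2 ^ (n + 1) * volume.real (E ∩ ball y (2 * t)) ≤ (2 * t) ^ n * v n := by
    by_contra! hcon
    exact htn ⟨by positivity, hcon⟩
  have h2 : volume.real (E ∩ ball y t) ≤ volume.real (E ∩ ball y (2 * t)) :=
    measureReal_mono (Set.inter_subset_inter_right _ (ball_subset_ball (by linarith)))
      (measure_ne_top_of_subset Set.inter_subset_left hfin)
  have h3 : volume.real (E ∩ ball y t) ≤ t ^ n * v n / 2 := by
    rw [mul_pow, pow_succ] at h1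
    have : (0:ℝ) < 2 ^ n := by positivity
    have h4 : 2 ^ n * (2 * volume.real (E ∩ ball y (2 * t))) ≤ 2 ^ n * (t ^ n * v n) := by
      linarith
    have := le_of_mul_le_mul_left h4 this
    linarith
  have h4 : ball y t \ E ⊆ (Phi E \ E) ∩ ball x (2 * t) := by
    rintro z ⟨hz, hzE⟩
    refine ⟨⟨Set.mem_biUnion htT hz, hzE⟩, ?_⟩
    rw [mem_ball] at *
    have := dist_triangle_right z x y
    simp only at hxp
    linarith
  have h5 : volume.real (ball y t \ E) ≤ volume.real ((Phi E \ E) ∩ ball x (2 * t)) :=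
    measureReal_mono h4 (measure_ne_top_of_subset Set.inter_subset_right measure_ball_lt_top.ne)
  have h6 : volume.real (ball y t ∩ E) + volume.real (ball y t \ E) = volume.real (ball y t) :=
    measureReal_inter_add_sdiff hEm measure_ball_lt_top.ne
  rw [vol_ball' y ht0, Set.inter_comm] at h6
  have h7 : v n / 2 ^ (n + 1) * (2 * t) ^ n = t ^ n * v n / 2 := by
    rw [mul_pow, pow_succ]; field_simp
  linarith

lemma iterate (hn : 0 < n) {θ : ℝ≥0∞}
    (hstep : ∀ E : Set (EuclideanSpace ℝ (Fin n)), IsOpen E → volume E ≠ ⊤ →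
      (∃ σ : ℝ, 0 < σ ∧ volume.real E ≤ σ ^ n * v n) → N q E ≤ θ * N q (Phi E))
    (hq1 : ∀ x, 1 < q x) (c : EuclideanSpace ℝ (Fin n)) (ρ : ℝ) (J : ℕ) :
    ∀ (E : Set (EuclideanSpace ℝ (Fin n))) (σ : ℝ), IsOpen E → 0 < σ → E ⊆ ball c (ρ + σ) →
      volume.real E ≤ σ ^ n * v n → N q E ≤ θ ^ J * N q (ball c (ρ + 20 ^ J * σ)) := by
  induction J with
  | zero =>
    intro E σ hE hσ hsub hvol
    simpa using N_mono hq1 hE.measurableSet measurableSet_ball hsub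
  | succ J ih =>
    intro E σ hE hσ hsub hvol
    have hfin : volume E ≠ ⊤ := measure_ne_top_of_subset hsub measure_ball_lt_top.ne
    have h1 := hstep E hE hfin ⟨σ, hσ, hvol⟩
    have h2 := ih (Phi E) (20 * σ) (Phi_open E) (by positivity)
      ((Phi_sub hn hfin hσ hvol hsub).trans (ball_subset_ball (by linarith)))
      ((Phi_vol hn hE.measurableSet hfin hσ hvol).trans (by
        rw [mul_pow, mul_assoc]; gcongr))
    calc N q E ≤ θ * N q (Phi E) := h1
      _ ≤ θ * (θ ^ J * N q (ball c (ρ + 20 ^ J * (20 * σ)))) := by gcongr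
      _ = _ := by rw [← mul_assoc, ← mul_assoc, ← pow_succ', ← pow_succ]

lemma N_null (hq1 : ∀ x, 1 < q x) {S : Set (EuclideanSpace ℝ (Fin n))} (hS : MeasurableSet S)
    (h : volume S = 0) : N q S = 0 := by
  by_contra hcon
  obtain ⟨a, ha, ha2⟩ := exists_between (pos_iff_ne_zero.2 hcon)
  apply absurd ha2
  rw [not_lt]
  apply N_le hq1 hS ha.ne'
  rw [setLIntegral_measure_zero _ _ h]
  simp

end Stmt11Aux

open Stmt11Aux in
/-- main theorem -/
theorem stmt11 (n : ℕ) (hn : 0 < n) (q : EuclideanSpace ℝ (Fin n) → ℝ)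
    (hqmeas : Measurable q) (hq1 : ∀ x, 1 < q x) (hqbdd : ∃ K : ℝ, ∀ x, q x ≤ K)
    (hM : ∃ A : ℝ≥0∞, A ≠ ⊤ ∧ ∀ f : EuclideanSpace ℝ (Fin n) → ℝ,
      vLpNorm q (maxOp f) ≤ A * vLpNorm q f) :
    ∃ δ : ℝ, 0 < δ ∧ δ < 1 ∧ ∃ C > 0,
      ∀ (c : EuclideanSpace ℝ (Fin n)) (r : ℝ), 0 < r →
        ∀ S : Set (EuclideanSpace ℝ (Fin n)), MeasurableSet S → S ⊆ closedBall c r →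
          vLpNorm q (S.indicator fun _ => (1:ℝ)) ≤
            ENNReal.ofReal C * (volume S / volume (closedBall c r)) ^ δ *
              vLpNorm q ((closedBall c r).indicator fun _ => (1:ℝ)) := by
  obtain ⟨K, hK⟩ := hqbdd
  obtain ⟨A, hA, hM⟩ := hM
  obtain ⟨a, rfl⟩ : ∃ a : ℝ, A = ENNReal.ofReal a := ⟨A.toReal, (ENNReal.ofReal_toReal hA).symm⟩
  have hv : 0 < v n := v_pos
  have hκ : 0 < v n / 2 ^ (n + 1) := by positivity
  have hmul : ∀ {κ : ℝ} {X Y : ℝ≥0∞}, 0 < κ → ENNReal.ofReal κ * X ≤ ENNReal.ofReal a * Y →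
      X ≤ ENNReal.ofReal (max 1 (a / κ)) * Y := by
    intro κ X Y hκ h
    have h1 : X ≤ (ENNReal.ofReal a * Y) / ENNReal.ofReal κ := by
      rw [ENNReal.le_div_iff_mul_le (Or.inl (by simpa using hκ)) (Or.inl ENNReal.ofReal_ne_top),
        mul_comm]
      exact h
    refine h1.trans ?_
    rw [ENNReal.mul_div_right_comm, ← ENNReal.ofReal_div_of_pos hκ]
    gcongr
    exact le_max_right _ _
  obtain ⟨θ, hθ2, hθ1, hθ⟩ := N_theta hq1 hK (L := max 1 (a / (v n / 2 ^ (n + 1)))) (le_max_left _ _)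
  have hθ0 : 0 < θ := by linarith
  have hstep : ∀ E : Set (EuclideanSpace ℝ (Fin n)), IsOpen E → volume E ≠ ⊤ →
      (∃ σ : ℝ, 0 < σ ∧ volume.real E ≤ σ ^ n * v n) →
      N q E ≤ ENNReal.ofReal θ * N q (Phi E) := by
    rintro E hE hfin ⟨σ, hσ, hvol⟩
    apply hθ E (Phi E) hE.measurableSet (Phi_open E).measurableSet (sub_Phi hE)
    apply hmul hκ
    exact N_max hq1 hM (Phi_open E).measurableSet
      ((Phi_open E).measurableSet.diff hE.measurableSet) hκ
      fun x hx => Phi_max hn hE.measurableSet hfin hσ hvol hx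
  have hnr : (0:ℝ) < n := by exact_mod_cast hn
  have hn1 : (1:ℝ) ≤ n := by exact_mod_cast hn
  have hl20 : 0 < Real.log 20 := Real.log_pos (by norm_num)
  have hlθ : Real.log θ < 0 := Real.log_neg hθ0 hθ1
  have hκ0 : 0 < v n / 44 ^ n := by positivity
  set δ : ℝ := -Real.log θ / (n * Real.log 20) with hδ
  have hδ0 : 0 < δ := div_pos (by linarith) (by positivity)
  refine ⟨δ, hδ0, ?_, max 1 (a / (v n / 44 ^ n)), by positivity, ?_⟩
  · rw [hδ, div_lt_one (by positivity)]
    have h1 : Real.log (1/20) < Real.log θ := Real.log_lt_log (by norm_num) (by linarith)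
    rw [one_div, Real.log_inv] at h1
    nlinarith
  intro c r hr S hS hSB
  change N q S ≤ _ * N q (closedBall c r)
  have hBvol : volume.real (closedBall c r) = r ^ n * v n := by
    have := Measure.addHaar_real_closedBall (volume : Measure (EuclideanSpace ℝ (Fin n))) c hr.le
    simpa [v] using this
  have hBfin : volume (closedBall c r) ≠ ⊤ := measure_closedBall_lt_top.ne
  have hSfin : volume S ≠ ⊤ := measure_ne_top_of_subset hSB hBfin
  by_cases hS0 : volume S = 0
  · rw [N_null hq1 hS hS0]; exact zero_le
  have hSpos : 0 < volume.real S := ENNReal.toReal_pos hS0 hSfin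
  obtain ⟨τ, hτ0, hτ⟩ : ∃ τ : ℝ, 0 < τ ∧ volume.real S = τ ^ n * v n := by
    refine ⟨(volume.real S / v n) ^ ((n:ℝ)⁻¹), by positivity, ?_⟩
    rw [Real.rpow_inv_natCast_pow (by positivity) hn.ne']
    field_simp
  have hτr : τ ≤ r := by
    have h1 : volume.real S ≤ volume.real (closedBall c r) := measureReal_mono hSB hBfin
    rw [hτ, hBvol] at h1
    exact le_of_pow_le_pow_left₀ hn.ne' hr.le (le_of_mul_le_mul_right h1 hv)
  obtain ⟨U, hSU, hU, hUvol⟩ := Set.exists_isOpen_lt_of_lt S (ENNReal.ofReal ((2 * τ) ^ n * v n)) (by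
    rw [← ENNReal.ofReal_toReal hSfin]
    apply (ENNReal.ofReal_lt_ofReal_iff (by positivity)).2
    rw [← measureReal_def, hτ]
    gcongr
    linarith)
  obtain ⟨J, hJ1, hJ2⟩ := exists_nat_pow_near (x := 20 * (r / τ)) (y := (20:ℝ)) (by
    have : 1 ≤ r / τ := by rwa [one_le_div hτ0]
    linarith) (by norm_num)
  have hit := iterate hn hstep hq1 c (2 * r) J (U ∩ ball c (2 * r)) (2 * τ)
    (hU.inter isOpen_ball) (by positivity)
    (Set.inter_subset_right.trans (ball_subset_ball (by linarith))) (by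
      refine (measureReal_mono Set.inter_subset_left (ne_top_of_lt hUvol)).trans ?_
      exact ENNReal.toReal_le_of_le_ofReal (by positivity) hUvol.le)
  have h42 : N q (ball c (2 * r + 20 ^ J * (2 * τ))) ≤ N q (ball c (42 * r)) := by
    apply N_mono hq1 measurableSet_ball measurableSet_ball
    apply ball_subset_ball
    have : 20 ^ J * τ ≤ 20 * r := by
      calc 20 ^ J * τ ≤ 20 * (r / τ) * τ := by gcongr
        _ = 20 * r := by field_simp
    linarith
  have hdoub : N q (ball c (42 * r)) ≤
      ENNReal.ofReal (max 1 (a / (v n / 44 ^ n))) * N q (closedBall c r) := by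
    apply hmul hκ0
    apply N_max hq1 hM measurableSet_ball measurableSet_closedBall hκ0
    intro x hx
    refine ⟨44 * r, by positivity, ?_⟩
    rw [Set.inter_eq_left.2, hBvol, mul_pow]
    · apply le_of_eq; field_simp
    · intro z hz
      rw [mem_ball] at *
      rw [mem_closedBall] at hz
      have := dist_triangle_right z x c
      linarith
  have hpow : ENNReal.ofReal θ ^ J ≤ (volume S / volume (closedBall c r)) ^ δ := by
    have h1 : volume S / volume (closedBall c r) = ENNReal.ofReal ((τ / r) ^ n) := by
      rw [← ENNReal.ofReal_toReal hSfin, ← ENNReal.ofReal_toReal hBfin, ← measureReal_def,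
        ← measureReal_def, hτ, hBvol, ← ENNReal.ofReal_div_of_pos (by positivity), div_pow]
      congr 1
      field_simp
    rw [h1, ENNReal.ofReal_rpow_of_pos (by positivity), ← ENNReal.ofReal_pow hθ0.le]
    apply ENNReal.ofReal_le_ofReal
    rw [← Real.log_le_log_iff (by positivity) (by positivity), Real.log_pow,
      Real.log_rpow (by positivity), Real.log_pow, Real.log_div hτ0.ne' hr.ne']
    have h2 : Real.log (20 * (r / τ)) ≤ Real.log (20 ^ (J + 1)) :=
      Real.log_le_log (by positivity) hJ2.le
    rw [Real.log_mul (by norm_num) (by positivity), Real.log_pow, Real.log_div hr.ne' hτ0.ne'] at h2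
    push_cast at h2
    have h3 : Real.log θ = -(δ * n * Real.log 20) := by
      rw [hδ]; field_simp
    rw [h3]
    have h4 : 0 < δ * n := by positivity
    nlinarith
  calc N q S ≤ N q (U ∩ ball c (2 * r)) := by
        apply N_mono hq1 hS (hU.inter isOpen_ball).measurableSet
        refine Set.subset_inter hSU (hSB.trans (closedBall_subset_ball (by linarith)))
    _ ≤ _ := hit
    _ ≤ (volume S / volume (closedBall c r)) ^ δ *
        (ENNReal.ofReal (max 1 (a / (v n / 44 ^ n))) * N q (closedBall c r)) := by
        gcongr
        exact h42.trans hdoub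
    _ = _ := by ring
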